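/- Let N > 1 be a natural number, let a < b be real numbers, and let x : Fin N → ℝ satisfy a ≤ x j ≤ b for all j, with mean μ = (1/N)·∑_{j} x j. Model a sample of size m drawn without replacement by choosing a permutation σ of Fin N uniformly at random and forming the sample mean X̄_m = (1/m)·∑_{t=0}^{m-1} x (σ t). Then for every natural number m with 1 ≤ m ≤ N and every δ ∈ (0,1], the probability (over the uniformly random permutation σ) of the event X̄_m − μ ≤ (b − a)·√(ρ_m · log(1/δ) / (2m)) is at least 1 − δ, where ρ_m = min{1 − (m−1)/N, (1 − m/N)(1 + 1/m)}. -/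

import Mathlib

/-- Hoeffding's lemma for a uniformly random entry of a finite list. -/
theorem sum_exp_sub_mean_le (n : ℕ) (a b : ℝ) (x : Fin (n + 1) → ℝ)
    (hx : ∀ j, a ≤ x j ∧ x j ≤ b) (l : ℝ) :
    ∑ p, Real.exp (l * (x p - (∑ j, x j) / (n + 1))) ≤
      (n + 1) * Real.exp (l ^ 2 * (b - a) ^ 2 / 8) := by
  have h := (ProbabilityTheory.hasSubgaussianMGF_of_mem_Icc (X := x) (a := a) (b := b)
    (μ := (PMF.uniformOfFintype (Fin (n + 1))).toMeasure)
    (measurable_of_finite x).aemeasurable (Filter.Eventually.of_forall hx)).mgf_le l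
  simp only [ProbabilityTheory.mgf, PMF.integral_eq_sum, PMF.uniformOfFintype_apply,
    Fintype.card_fin, smul_eq_mul, ← Finset.mul_sum] at h
  have hc : ((((n + 1 : ℕ) : ENNReal)⁻¹).toReal) = ((n : ℝ) + 1)⁻¹ := by
    rw [ENNReal.toReal_inv, ENNReal.toReal_natCast]
    push_cast
    rfl
  have hv : ((((‖b - a‖₊ / 2) ^ 2 : NNReal) : ℝ)) * l ^ 2 / 2 = l ^ 2 * (b - a) ^ 2 / 8 := by
    push_cast
    rw [Real.norm_eq_abs, div_pow, sq_abs]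
    ring
  rw [hc, hv, inv_mul_le_iff₀ (by positivity)] at h
  simpa only [div_eq_inv_mul] using h

/-- Exponential moment bound for the centered sum of a sample drawn without replacement, by
conditioning on the first draw. -/
theorem sum_perm_exp_le (a b : ℝ) : ∀ (N m : ℕ), m ≤ N → ∀ (x : Fin N → ℝ),
    (∀ j, a ≤ x j ∧ x j ≤ b) → ∀ l : ℝ,
    ∑ σ : Equiv.Perm (Fin N), Real.exp (l *
        ((∑ t ∈ Finset.univ.filter (fun t : Fin N => (t : ℕ) < m), x (σ t))
          - (m : ℝ) / N * ∑ j, x j)) ≤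
      (N.factorial : ℝ) * Real.exp (l ^ 2 * (b - a) ^ 2 / 8 * ((m : ℝ) * (N - m + 1) / N))
  | N, 0, _, x, _, l => by simp [Fintype.card_perm]
  | 0, m + 1, hm, _, _, _ => by omega
  | 1, m + 1, hm, x, hx, l => by
    obtain rfl : m = 0 := by omega
    simp
    positivity
  | N + 2, m + 1, hm, x, hx, l => by
    have hm' : m ≤ N + 1 := by omega
    have hmR : (m : ℝ) ≤ N + 1 := by exact_mod_cast hm'
    have hN : (0 : ℝ) < N + 1 := by positivity
    set y : Fin (N + 2) → Fin (N + 1) → ℝ := fun p i => x (Equiv.swap 0 p i.succ) with hy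
    have hsum (p : Fin (N + 2)) : ∑ i, y p i = ∑ j, x j - x p := by
      have h := Equiv.sum_comp (Equiv.swap 0 p) x
      rw [Fin.sum_univ_succ, Equiv.swap_apply_left] at h
      simp only [hy]
      linarith
    have hfirst (p : Fin (N + 2)) (e : Equiv.Perm (Fin (N + 1))) :
        l * ((∑ t ∈ Finset.univ.filter (fun t : Fin (N + 2) => (t : ℕ) < m + 1),
            x (Equiv.Perm.decomposeFin.symm (p, e) t))
          - ((m + 1 : ℕ) : ℝ) / (N + 2 : ℕ) * ∑ j, x j) =
        (l * ((N + 1 - m) / (N + 1))) * (x p - (∑ j, x j) / ((N + 1 : ℕ) + 1)) +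
        l * ((∑ t ∈ Finset.univ.filter (fun t : Fin (N + 1) => (t : ℕ) < m), y p (e t))
          - (m : ℝ) / (N + 1 : ℕ) * ∑ i, y p i) := by
      rw [hsum, Finset.sum_filter, Fin.sum_univ_succ]
      simp only [Equiv.Perm.decomposeFin_symm_apply_zero,
        Equiv.Perm.decomposeFin_symm_apply_succ, Fin.val_zero, Fin.val_succ,
        Nat.add_lt_add_iff_right, Nat.succ_pos, if_true, ← Finset.sum_filter, hy]
      generalize (∑ t ∈ Finset.univ.filter (fun t : Fin (N + 1) => (t : ℕ) < m),
        x (Equiv.swap 0 p (e t).succ)) = S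
      push_cast
      have : (N : ℝ) + 1 + 1 ≠ 0 := by positivity
      field_simp
      ring
    have hvar : ((N + 1 - m) / (N + 1 : ℝ)) ^ 2 + (m : ℝ) * ((N + 1 : ℕ) - m + 1) / (N + 1 : ℕ) ≤
        ((m + 1 : ℕ) : ℝ) * ((N + 2 : ℕ) - (m + 1 : ℕ) + 1) / (N + 2 : ℕ) := by
      push_cast
      rw [← sub_nonneg]
      have : ((m : ℝ) + 1) * (N + 2 - (m + 1) + 1) / (N + 2) -
          (((N + 1 - m) / (N + 1 : ℝ)) ^ 2 + (m : ℝ) * (N + 1 - m + 1) / (N + 1)) =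
          (N + 1 - m) * m / ((N + 2) * (N + 1) ^ 2) := by
        field_simp
        ring
      rw [this]
      have : (0 : ℝ) ≤ N + 1 - m := by linarith
      positivity
    rw [← Equiv.sum_comp Equiv.Perm.decomposeFin.symm, Fintype.sum_prod_type]
    simp only [hfirst, Real.exp_add, ← Finset.mul_sum]
    set B := ((N + 1).factorial : ℝ) * Real.exp (l ^ 2 * (b - a) ^ 2 / 8 *
      ((m : ℝ) * ((N + 1 : ℕ) - m + 1) / (N + 1 : ℕ))) with hB
    calc _ ≤ ∑ p, Real.exp ((l * ((N + 1 - m) / (N + 1))) *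
            (x p - (∑ j, x j) / ((N + 1 : ℕ) + 1))) * B :=
          Finset.sum_le_sum fun p _ => mul_le_mul_of_nonneg_left
            (sum_perm_exp_le a b (N + 1) m hm' (y p) (fun i => hx _) l) (Real.exp_pos _).le
      _ ≤ ((N + 1 : ℕ) + 1) * Real.exp ((l * ((N + 1 - m) / (N + 1))) ^ 2 * (b - a) ^ 2 / 8) *
            B := by
          rw [← Finset.sum_mul]
          exact mul_le_mul_of_nonneg_right (sum_exp_sub_mean_le (N + 1) a b x hx _)
            (by positivity)
      _ = ((N + 2).factorial : ℝ) * Real.exp (l ^ 2 * (b - a) ^ 2 / 8 *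
            (((N + 1 - m) / (N + 1 : ℝ)) ^ 2 +
              (m : ℝ) * ((N + 1 : ℕ) - m + 1) / (N + 1 : ℕ))) := by
          rw [hB, mul_add (l ^ 2 * (b - a) ^ 2 / 8), Real.exp_add, Nat.factorial_succ (N + 1)]
          push_cast
          ring_nf
      _ ≤ _ := by gcongr

/-- The exponential moment bound obtained by passing to the complementary sample. -/
theorem sum_perm_exp_le_compl (a b : ℝ) (N m : ℕ) (hN : 0 < N) (hm : m ≤ N) (x : Fin N → ℝ)
    (hx : ∀ j, a ≤ x j ∧ x j ≤ b) (l : ℝ) :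
    ∑ σ : Equiv.Perm (Fin N), Real.exp (l *
        ((∑ t ∈ Finset.univ.filter (fun t : Fin N => (t : ℕ) < m), x (σ t))
          - (m : ℝ) / N * ∑ j, x j)) ≤
      (N.factorial : ℝ) * Real.exp (l ^ 2 * (b - a) ^ 2 / 8 * (((N : ℝ) - m) * (m + 1) / N)) := by
  have hNR : (N : ℝ) ≠ 0 := by positivity
  have h := sum_perm_exp_le (-b) (-a) N (N - m) (Nat.sub_le _ _) (fun j => -x j)
    (fun j => ⟨neg_le_neg (hx j).2, neg_le_neg (hx j).1⟩) l
  rw [← Equiv.sum_comp (Equiv.mulRight Fin.revPerm), Nat.cast_sub hm] at h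
  convert h using 1
  · refine Finset.sum_congr rfl fun σ _ => ?_
    congr 2
    have hrev : ∑ t ∈ Finset.univ.filter (fun t : Fin N => (t : ℕ) < N - m),
        x (σ t.rev) = ∑ t ∈ Finset.univ.filter (fun t : Fin N => ¬ (t : ℕ) < m), x (σ t) := by
      simp only [Finset.sum_filter]
      rw [← Equiv.sum_comp Fin.revPerm]
      refine Finset.sum_congr rfl fun t _ => ?_
      have ht := t.isLt
      simp only [Fin.revPerm_apply, Fin.rev_rev, Fin.val_rev]
      refine if_congr ?_ rfl rfl
      omega
    have hsplit := Finset.sum_filter_add_sum_filter_not Finset.univ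
      (fun t : Fin N => (t : ℕ) < m) (fun t => x (σ t))
    rw [Equiv.sum_comp σ x] at hsplit
    simp only [Equiv.coe_mulRight, Equiv.Perm.mul_apply, Fin.revPerm_apply,
      Finset.sum_neg_distrib, hrev, ← hsplit]
    field_simp
    ring
  · congr 2
    ring

/-- Chernoff bound for a finite family of exponential moments with sub-Gaussian growth. -/
theorem card_filter_lt_le_of_sum_exp_le {ι : Type*} [Fintype ι] (f : ι → ℝ) (C v ε : ℝ)
    (hv : 0 < v) (hε : 0 ≤ ε)
    (h : ∀ l : ℝ, ∑ i, Real.exp (l * f i) ≤ C * Real.exp (l ^ 2 * v / 2)) :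
    ((Finset.univ.filter (fun i => ε < f i)).card : ℝ) ≤ C * Real.exp (-(ε ^ 2 / (2 * v))) := by
  have key : ((Finset.univ.filter (fun i => ε < f i)).card : ℝ) * Real.exp (ε / v * ε) ≤
      C * Real.exp ((ε / v) ^ 2 * v / 2) := by
    refine le_trans ?_ (h (ε / v))
    rw [← nsmul_eq_mul]
    refine (Finset.card_nsmul_le_sum _ (fun i => Real.exp (ε / v * f i)) _ ?_).trans
      (Finset.sum_le_sum_of_subset_of_nonneg (Finset.filter_subset _ _)
        fun _ _ _ => (Real.exp_pos _).le)
    intro i hi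
    have := (Finset.mem_filter.mp hi).2.le
    gcongr
  rw [← le_div_iff₀ (Real.exp_pos _), mul_div_assoc, ← Real.exp_sub] at key
  have hexp : (ε / v) ^ 2 * v / 2 - ε / v * ε = -(ε ^ 2 / (2 * v)) := by
    field_simp
    ring
  rwa [hexp] at key

/-- Concentration for sampling without replacement (Bardenet–Maillard, Corollary 2.5),
modeled via a uniformly random permutation of `Fin N`: the upper-tail bound
`X̄_m − μ ≤ (b − a)·√(ρ_m · log(1/δ) / (2m))` holds with probability at least `1 − δ`. -/
theorem stmt0 (N : ℕ) (hN : 1 < N) (a b : ℝ) (hab : a < b)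
    (x : Fin N → ℝ) (hx : ∀ j, a ≤ x j ∧ x j ≤ b)
    (m : ℕ) (hm1 : 1 ≤ m) (hmN : m ≤ N)
    (δ : ℝ) (hδ0 : 0 < δ) (hδ1 : δ ≤ 1) :
    1 - δ ≤
      (Nat.card {σ : Equiv.Perm (Fin N) //
          (1 / (m : ℝ)) * (∑ t ∈ Finset.univ.filter (fun t : Fin N => (t : ℕ) < m), x (σ t))
              - (1 / (N : ℝ)) * ∑ j, x j
            ≤ (b - a) * Real.sqrt
                ((min (1 - ((m : ℝ) - 1) / N) ((1 - (m : ℝ) / N) * (1 + 1 / (m : ℝ)))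
                  * Real.log (1 / δ)) / (2 * m))} : ℝ)
        / (Nat.card (Equiv.Perm (Fin N)) : ℝ) := by
  have hmR : (0 : ℝ) < m := by exact_mod_cast hm1
  have hNR : (0 : ℝ) < N := by positivity
  set r := min (1 - ((m : ℝ) - 1) / N) ((1 - (m : ℝ) / N) * (1 + 1 / (m : ℝ))) with hr
  set f : Equiv.Perm (Fin N) → ℝ := fun σ =>
    (∑ t ∈ Finset.univ.filter (fun t : Fin N => (t : ℕ) < m), x (σ t))
      - (m : ℝ) / N * ∑ j, x j with hf
  set ε := (b - a) * Real.sqrt (r * Real.log (1 / δ) / (2 * m)) with hε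
  have hε0 : 0 ≤ ε := mul_nonneg (by linarith) (Real.sqrt_nonneg _)
  have hL : 0 ≤ Real.log (1 / δ) := Real.log_nonneg (by rw [le_div_iff₀ hδ0]; linarith)
  have hevent (σ : Equiv.Perm (Fin N)) :
      (1 / (m : ℝ)) * (∑ t ∈ Finset.univ.filter (fun t : Fin N => (t : ℕ) < m), x (σ t))
        - (1 / (N : ℝ)) * ∑ j, x j ≤ ε ↔ ¬ m * ε < f σ := by
    have : (1 / (m : ℝ)) * (∑ t ∈ Finset.univ.filter (fun t : Fin N => (t : ℕ) < m), x (σ t))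
        - (1 / (N : ℝ)) * ∑ j, x j = f σ / m := by
      simp only [hf]
      field_simp
    rw [this, div_le_iff₀ hmR, not_lt, mul_comm]
  have hbad : ((Finset.univ.filter (fun σ => m * ε < f σ)).card : ℝ) ≤ N.factorial * δ := by
    rcases hmN.eq_or_lt with rfl | hlt
    · rw [Finset.filter_false_of_mem]
      · simp only [Finset.card_empty, Nat.cast_zero]
        positivity
      · intro σ _
        have : f σ = 0 := by
          simp [hf, Finset.filter_true_of_mem, Equiv.sum_comp σ x, hmR.ne']
        rw [this, not_lt]
        positivity
    · have hltR : (m : ℝ) < N := by exact_mod_cast hlt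
      have hr0 : 0 < r := by
        refine lt_min ?_ (mul_pos ?_ (by positivity))
        · rw [sub_pos, div_lt_one hNR]
          linarith
        · rw [sub_pos, div_lt_one hNR]
          exact hltR
      have hba : 0 < b - a := sub_pos.mpr hab
      have hmgf (l : ℝ) : ∑ σ, Real.exp (l * f σ) ≤
          N.factorial * Real.exp (l ^ 2 * ((b - a) ^ 2 * (m * r) / 4) / 2) := by
        rcases min_choice (1 - ((m : ℝ) - 1) / N) ((1 - (m : ℝ) / N) * (1 + 1 / (m : ℝ)))
          with h | h
        · convert sum_perm_exp_le a b N m hmN x hx l using 3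
          rw [hr, h]
          field_simp
          ring
        · convert sum_perm_exp_le_compl a b N m (by omega) hmN x hx l using 3
          rw [hr, h]
          field_simp
          ring
      refine (card_filter_lt_le_of_sum_exp_le f _ _ (m * ε) (by positivity) (by positivity)
        hmgf).trans_eq ?_
      congr 1
      have hexp : (m * ε) ^ 2 / (2 * ((b - a) ^ 2 * (m * r) / 4)) = Real.log (1 / δ) := by
        rw [hε, mul_pow, mul_pow, Real.sq_sqrt (by positivity)]
        field_simp
        ring
      rw [hexp, one_div, Real.log_inv, neg_neg, Real.exp_log hδ0]
  have hcompl := Finset.card_filter_add_card_filter_not (s := Finset.univ)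
    (fun σ : Equiv.Perm (Fin N) => m * ε < f σ)
  rw [Finset.card_univ, Fintype.card_perm, Fintype.card_fin] at hcompl
  have hcomplR : ((Finset.univ.filter (fun σ => m * ε < f σ)).card : ℝ) +
      (Finset.univ.filter (fun σ => ¬ m * ε < f σ)).card = N.factorial := by
    exact_mod_cast hcompl
  have hfac : (0 : ℝ) < N.factorial := by exact_mod_cast N.factorial_pos
  simp only [hevent]
  rw [Nat.card_eq_fintype_card, Nat.card_eq_fintype_card, Fintype.card_perm, Fintype.card_fin,
    Fintype.card_subtype, le_div_iff₀ hfac]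
  linarith
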